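/- The non-context-free language { w w | w ∈ {0, 1}* } is recognized by a nondeterministic real-time three-stack automaton, which nondeterministically guesses |w| and then proceeds as for { w # w | w ∈ {0,1}* }: writing w = uv with |u| = |v|, it pushes the first u to stack 1, pushes the first v to stack 2 while moving stack 1's symbols to stack 3 in reverse, matches the second u against symbols popped from stack 3 while moving stack 2's symbols to stack 1 in reverse, and matches the second v against symbols popped from stack 1. -/

import Mathlib

/-- An operation on a single stack: push a symbol, pop the top symbol, or do
nothing. -/
inductive StackOp (Γ : Type) where
  | push (y : Γ)
  | pop
  | noop

/-- Apply a stack operation to a stack (head = top). -/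
def StackOp.apply {Γ : Type} : StackOp Γ → List Γ → List Γ
  | .push y, s => y :: s
  | .pop, s => s.tail
  | .noop, s => s

/-- A real-time `k`-stack automaton over the input alphabet `α`: it has a finite
state set `Q` with start state `q0` and accept states `F`, a finite stack
alphabet `Γ` with bottom symbol `bot`, and a transition relation
`δ`: a transition `(q, tops, a, r, ops)` applies when the machine is in state
`q`, the top symbols of its `k` stacks are `tops`, and it scans the input symbol
`a`; it then moves to state `r` and performs on each stack `i` the operation
`ops i` (a push, a pop, or a no-op). Exactly one input symbol is scanned per
timestep. -/
structure MultiStackAutomaton (k : ℕ) (α : Type) where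
  /-- states -/
  Q : Type
  /-- stack alphabet -/
  Γ : Type
  [finQ : Fintype Q]
  [finΓ : Fintype Γ]
  /-- start state -/
  q0 : Q
  /-- accept states -/
  F : Set Q
  /-- bottom stack symbol -/
  bot : Γ
  /-- transitions -/
  δ : Set (Q × (Fin k → Γ) × α × Q × (Fin k → StackOp Γ))

attribute [instance] MultiStackAutomaton.finQ MultiStackAutomaton.finΓ

namespace MultiStackAutomaton

variable {k : ℕ} {α : Type}

/-- `M.Steps c w c'` means the automaton `M` can go from configuration `c`
(state and `k` stacks, head = top) to configuration `c'`, scanning exactly one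
input symbol of `w` per timestep. -/
inductive Steps (M : MultiStackAutomaton k α) :
    (M.Q × (Fin k → List M.Γ)) → List α → (M.Q × (Fin k → List M.Γ)) → Prop
  | refl (c : M.Q × (Fin k → List M.Γ)) : Steps M c [] c
  | step {q : M.Q} {tops : Fin k → M.Γ} {a : α} {r : M.Q}
      {ops : Fin k → StackOp M.Γ} {ss : Fin k → List M.Γ} {w : List α}
      {c : M.Q × (Fin k → List M.Γ)} :
      (q, tops, a, r, ops) ∈ M.δ →
      (∀ i, (ss i).head? = some (tops i)) →
      Steps M (r, fun i => (ops i).apply (ss i)) w c →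
      Steps M (q, ss) (a :: w) c

/-- The automaton accepts `w` iff some run reading the whole string, starting in
the start state with each stack containing only `⊥`, ends in an accept state. -/
def Accepts (M : MultiStackAutomaton k α) (w : List α) : Prop :=
  ∃ c : M.Q × (Fin k → List M.Γ), c.1 ∈ M.F ∧
    M.Steps (M.q0, fun _ => [M.bot]) w c

/-- The language recognized by the automaton. -/
def language (M : MultiStackAutomaton k α) : Language α := {w | M.Accepts w}

/-- The automaton is deterministic if at most one transition applies in any
configuration. -/
def Deterministic (M : MultiStackAutomaton k α) : Prop :=
  ∀ (q : M.Q) (tops : Fin k → M.Γ) (a : α) (r₁ r₂ : M.Q)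
    (ops₁ ops₂ : Fin k → StackOp M.Γ),
    (q, tops, a, r₁, ops₁) ∈ M.δ → (q, tops, a, r₂, ops₂) ∈ M.δ →
    r₁ = r₂ ∧ ops₁ = ops₂

end MultiStackAutomaton

/-- The copy language `{ w w | w ∈ {0, 1}* }` over the alphabet `{0, 1}`
(represented by `Bool`). -/
def wwLanguage : Language Bool :=
  {u | ∃ w : List Bool, u = w ++ w}

namespace ContextFreeGrammar

variable {T : Type*} {g : ContextFreeGrammar T}

/-- `g.Yields s w` means that the sentential form `s` derives the terminal word `w`, presented
symbol by symbol as a forest of parse trees. -/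
inductive Yields (g : ContextFreeGrammar T) : List (Symbol T g.NT) → List T → Prop
  | nil : Yields g [] []
  | terminal (t : T) {s : List (Symbol T g.NT)} {w : List T} :
      Yields g s w → Yields g (.terminal t :: s) (t :: w)
  | nonterminal {ρ : ContextFreeRule T g.NT} {s : List (Symbol T g.NT)} {u w : List T} :
      ρ ∈ g.rules → Yields g ρ.output u → Yields g s w →
      Yields g (.nonterminal ρ.input :: s) (u ++ w)

theorem Yields.exists_of_append {s₁ s₂ : List (Symbol T g.NT)} {w : List T}
    (h : g.Yields (s₁ ++ s₂) w) :
    ∃ w₁ w₂, w = w₁ ++ w₂ ∧ g.Yields s₁ w₁ ∧ g.Yields s₂ w₂ := by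
  induction s₁ generalizing w with
  | nil => exact ⟨[], w, rfl, .nil, h⟩
  | cons a s₁ ih =>
    cases h with
    | terminal t h =>
      obtain ⟨w₁, w₂, rfl, h₁, h₂⟩ := ih h
      exact ⟨t :: w₁, w₂, rfl, .terminal t h₁, h₂⟩
    | nonterminal hρ hu h =>
      obtain ⟨w₁, w₂, rfl, h₁, h₂⟩ := ih h
      exact ⟨_ ++ w₁, w₂, by simp, .nonterminal hρ hu h₁, h₂⟩

theorem Yields.append {s₁ s₂ : List (Symbol T g.NT)} {w₁ w₂ : List T}
    (h₁ : g.Yields s₁ w₁) (h₂ : g.Yields s₂ w₂) : g.Yields (s₁ ++ s₂) (w₁ ++ w₂) := by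
  induction h₁ with
  | nil => exact h₂
  | terminal t _ ih => exact .terminal t ih
  | nonterminal hρ hu _ _ ih =>
    rw [List.append_assoc]
    exact .nonterminal hρ hu ih

theorem Yields.map_terminal (w : List T) : g.Yields (w.map .terminal) w := by
  induction w with
  | nil => exact .nil
  | cons t w ih => exact .terminal t ih

theorem Yields.of_derives {s : List (Symbol T g.NT)} {w : List T}
    (h : g.Derives s (w.map .terminal)) : g.Yields s w := by
  induction h using Relation.ReflTransGen.head_induction_on with
  | refl => exact .map_terminal w
  | head hp _ ih =>
    obtain ⟨ρ, hρ, hrw⟩ := hp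
    obtain ⟨p, q, rfl, rfl⟩ := hrw.exists_parts
    obtain ⟨w', w₃, rfl, h', h₃⟩ := ih.exists_of_append
    obtain ⟨w₁, w₂, rfl, h₁, h₂⟩ := h'.exists_of_append
    refine (h₁.append ?_).append h₃
    simpa using Yields.nonterminal hρ h₂ .nil

theorem Derives.of_rule {ρ : ContextFreeRule T g.NT} (hρ : ρ ∈ g.rules)
    {s : List (Symbol T g.NT)} (h : g.Derives ρ.output s) :
    g.Derives [.nonterminal ρ.input] s :=
  Produces.trans_derives ⟨ρ, hρ, .input_output⟩ h

theorem Derives.append {s₁ s₂ t₁ t₂ : List (Symbol T g.NT)}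
    (h₁ : g.Derives s₁ t₁) (h₂ : g.Derives s₂ t₂) : g.Derives (s₁ ++ s₂) (t₁ ++ t₂) :=
  (h₁.append_right s₂).trans (h₂.append_left t₁)

theorem Yields.derives {s : List (Symbol T g.NT)} {w : List T} (h : g.Yields s w) :
    g.Derives s (w.map .terminal) := by
  induction h with
  | nil => exact .refl _
  | terminal t _ ih => exact ih.append_left [.terminal t]
  | nonterminal hρ _ _ ihu ih =>
    rw [List.map_append]
    exact (Derives.of_rule hρ ihu).append ih

/-- A sentential form yielding a long word yields it through a nonterminal whose own yield has
length in `(K, r * K]`, where `r` bounds the lengths of the right-hand sides of the rules. -/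
theorem Yields.exists_infix {r K : ℕ} (hr : ∀ ρ ∈ g.rules, ρ.output.length ≤ r) (hK : 0 < K)
    {s : List (Symbol T g.NT)} {w : List T} (h : g.Yields s w) (hw : s.length * K < w.length) :
    ∃ ρ ∈ g.rules, ∃ x y z : List T, w = x ++ y ++ z ∧ K < y.length ∧ y.length ≤ r * K ∧
      g.Derives [.nonterminal ρ.input] (y.map .terminal) ∧
      g.Derives s (x.map .terminal ++ [.nonterminal ρ.input] ++ z.map .terminal) := by
  induction h with
  | nil => simp at hw
  | terminal t _ ih =>
    simp only [List.length_cons, add_mul, one_mul] at hw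
    obtain ⟨ρ, hρ, x, y, z, rfl, h₁, h₂, hy, hs⟩ := ih (by omega)
    exact ⟨ρ, hρ, t :: x, y, z, rfl, h₁, h₂, hy, by simpa using hs.append_left [.terminal t]⟩
  | @nonterminal ρ s u w hρ hu hs ihu ih =>
    simp only [List.length_cons, List.length_append, add_mul, one_mul] at hw
    by_cases hsw : s.length * K < w.length
    · obtain ⟨σ, hσ, x, y, z, rfl, h₁, h₂, hy, hs⟩ := ih hsw
      refine ⟨σ, hσ, u ++ x, y, z, by simp, h₁, h₂, hy, ?_⟩
      simpa using (Derives.of_rule hρ hu.derives).append hs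
    · by_cases hur : u.length ≤ r * K
      · exact ⟨ρ, hρ, [], u, w, rfl, by omega, hur, Derives.of_rule hρ hu.derives,
          by simpa using hs.derives.append_left [.nonterminal ρ.input]⟩
      · have hout : ρ.output.length * K ≤ r * K := Nat.mul_le_mul_right K (hr ρ hρ)
        obtain ⟨σ, hσ, x, y, z, rfl, h₁, h₂, hy, hx⟩ := ihu (by omega)
        refine ⟨σ, hσ, x, y, z ++ w, by simp, h₁, h₂, hy, ?_⟩
        simpa using (Derives.of_rule hρ hx).append hs.derives

/-- Every long word of a context-free language has an infix of length in `(K, r * K]` that may be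
replaced by any other word derived from the nonterminal generating it. -/
theorem exists_infix_of_mem_language {r K : ℕ} (hr : ∀ ρ ∈ g.rules, ρ.output.length ≤ r)
    (hK : 0 < K) {w : List T} (h : w ∈ g.language) (hw : K < w.length) :
    ∃ ρ ∈ g.rules, ∃ x y z : List T, w = x ++ y ++ z ∧ K < y.length ∧ y.length ≤ r * K ∧
      g.Derives [.nonterminal ρ.input] (y.map .terminal) ∧
      ∀ y' : List T, g.Derives [.nonterminal ρ.input] (y'.map .terminal) →
        x ++ y' ++ z ∈ g.language := by
  obtain ⟨ρ, hρ, x, y, z, rfl, h₁, h₂, hy, hs⟩ :=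
    (Yields.of_derives h).exists_infix hr hK (by simpa using hw)
  refine ⟨ρ, hρ, x, y, z, rfl, h₁, h₂, hy, fun y' hy' => ?_⟩
  rw [mem_language_iff, List.map_append, List.map_append]
  exact hs.trans ((hy'.append_left _).append_right _)

end ContextFreeGrammar

/-- The positions of a word `w` of length `n` that are covered, in `w ++ w`, by the window of
length `l` starting at position `p`. -/
def copyWindow (n p l : ℕ) : Finset (Fin n) :=
  {i | (p ≤ i ∧ i < p + l) ∨ (p ≤ i + n ∧ i + n < p + l)}

theorem le_card_copyWindow {n p l : ℕ} (hl : l ≤ n) (hp : p + l ≤ n + n) :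
    l ≤ (copyWindow n p l).card := by
  have hmod : ∀ j < l, (p + j < n ∧ (p + j) % n = p + j) ∨
      (n ≤ p + j ∧ (p + j) % n = p + j - n) := by
    intro j hj
    rcases lt_or_ge (p + j) n with h | h
    · exact .inl ⟨h, Nat.mod_eq_of_lt h⟩
    · exact .inr ⟨h, by rw [Nat.mod_eq_sub_mod h, Nat.mod_eq_of_lt (by omega)]⟩
  have hlt (j : Fin l) : (p + j) % n < n := Nat.mod_lt _ (by have := j.2; omega)
  have hinj : Function.Injective fun j : Fin l => (⟨(p + j) % n, hlt j⟩ : Fin n) := by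
    intro i j hij
    simp only [Fin.mk.injEq] at hij
    ext
    have := hmod i i.2
    have := hmod j j.2
    omega
  calc l = (Finset.univ.image fun j : Fin l => (⟨(p + j) % n, hlt j⟩ : Fin n)).card := by
        rw [Finset.card_image_of_injective _ hinj, Finset.card_univ, Fintype.card_fin]
    _ ≤ _ := by
        refine Finset.card_le_card fun i hi => ?_
        obtain ⟨j, -, rfl⟩ := Finset.mem_image.1 hi
        simp only [copyWindow, Finset.mem_filter, Finset.mem_univ, true_and]
        have := hmod j j.2
        omega

theorem eq_on_copyWindow_of_interchange {n : ℕ} {w w' : Fin n → Bool} {x y z x' y' z' : List Bool}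
    (h : List.ofFn w ++ List.ofFn w = x ++ y ++ z)
    (h' : List.ofFn w' ++ List.ofFn w' = x' ++ y' ++ z')
    (hx : x'.length = x.length) (hy : y'.length = y.length) (hn : y.length ≤ n)
    (hmem : x ++ y' ++ z ∈ wwLanguage) {i : Fin n} (hi : i ∈ copyWindow n x.length y.length) :
    w' i = w i := by
  obtain ⟨v, hv⟩ := hmem
  have hlen : n + n = x.length + y.length + z.length := by
    simpa [add_assoc] using congrArg List.length h
  have hvlen : x.length + y'.length + z.length = v.length + v.length := by
    simpa [add_assoc] using congrArg List.length hv
  have hvn : v.length = n := by omega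
  have e₁ : ∀ u : Fin n → Bool, (List.ofFn u ++ List.ofFn u)[(i : ℕ)]? = some (u i) := by
    intro u; simp [List.getElem?_append]
  have e₂ : ∀ u : Fin n → Bool, (List.ofFn u ++ List.ofFn u)[(i : ℕ) + n]? = some (u i) := by
    intro u; simp
  have hvv : (v ++ v)[(i : ℕ)]? = (v ++ v)[(i : ℕ) + n]? := by
    simp [List.getElem?_append, hvn]
  have a₁ := e₁ w
  have a₂ := e₂ w
  have b₁ := e₁ w'
  have b₂ := e₂ w'
  rw [h] at a₁ a₂
  rw [h'] at b₁ b₂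
  rw [← hv] at hvv
  simp only [copyWindow, Finset.mem_filter, Finset.mem_univ, true_and] at hi
  have hin := i.2
  simp only [List.getElem?_append, List.length_append, hx, hy] at a₁ a₂ b₁ b₂ hvv
  grind

theorem exists_mul_sq_lt_two_pow (C : ℕ) : ∃ k : ℕ, 0 < k ∧ C * k ^ 2 < 2 ^ k := by
  have h := tendsto_pow_const_div_const_pow_of_one_lt 2 (one_lt_two (α := ℝ))
  have h' := h.eventually_lt_const (show (0 : ℝ) < 1 / (C + 1) by positivity)
  obtain ⟨k, hk, hk₀⟩ := (h'.and (Filter.eventually_gt_atTop 0)).exists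
  refine ⟨k, hk₀, ?_⟩
  rw [div_lt_div_iff₀ (by positivity) (by positivity)] at hk
  have : k ^ 2 * (C + 1) < 1 * 2 ^ k := by exact_mod_cast hk
  nlinarith

theorem card_le_of_eq_on {n k : ℕ} {s : Finset (Fin n)} (hs : k ≤ s.card)
    {A : Finset (Fin n → Bool)} (hA : ∀ w ∈ A, ∀ w' ∈ A, ∀ i ∈ s, w' i = w i) :
    A.card ≤ 2 ^ (n - k) := by
  rcases A.eq_empty_or_nonempty with rfl | ⟨w, hw⟩
  · simp
  calc A.card
      ≤ (Fintype.piFinset fun i => if i ∈ s then {w i} else (Finset.univ : Finset Bool)).card := by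
        refine Finset.card_le_card fun w' hw' => Fintype.mem_piFinset.2 fun i => ?_
        split_ifs with hi
        · simpa using hA w hw w' hw' i hi
        · simp
    _ = 2 ^ (n - s.card) := by
        rw [Fintype.card_piFinset]
        simp only [apply_ite Finset.card, Finset.card_singleton, Finset.card_univ,
          Fintype.card_bool]
        rw [Finset.prod_ite, Finset.prod_const_one, one_mul, Finset.prod_const]
        congr 1
        rw [Finset.filter_not, Finset.filter_mem_eq_inter, Finset.univ_inter,
          Finset.card_sdiff_of_subset (Finset.subset_univ s), Finset.card_univ, Fintype.card_fin]
    _ ≤ _ := Nat.pow_le_pow_right two_pos (by omega)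

theorem not_isContextFree_wwLanguage : ¬ wwLanguage.IsContextFree := by
  classical
  rintro ⟨g, hg⟩
  obtain ⟨r, hr₀, hr⟩ : ∃ r : ℕ, 0 < r ∧ ∀ ρ ∈ g.rules, ρ.output.length ≤ r :=
    ⟨g.rules.sup (fun ρ => ρ.output.length) + 1, by omega, fun ρ hρ =>
      (Finset.le_sup (f := fun ρ => ρ.output.length) hρ).trans (Nat.le_succ _)⟩
  obtain ⟨k, hk₀, hk⟩ := exists_mul_sq_lt_two_pow (g.rules.card * 6 * r ^ 2)
  set n := r * k with hn
  have hkn : k ≤ n := Nat.le_mul_of_pos_left k hr₀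
  have hdec (w : Fin n → Bool) := g.exists_infix_of_mem_language hr hk₀
    (w := List.ofFn w ++ List.ofFn w) (by rw [hg]; exact ⟨_, rfl⟩) (by simp; omega)
  choose ρ hρ x y z hxyz hky hyn hder hrep using hdec
  have hlen (w : Fin n → Bool) : n + n = (x w).length + (y w).length + (z w).length := by
    simpa [add_assoc] using congrArg List.length (hxyz w)
  let cls (w : Fin n → Bool) := (ρ w, (x w).length, (y w).length)
  obtain ⟨c, -, hc⟩ := Finset.exists_lt_card_fiber_of_mul_lt_card_of_maps_to
    (s := Finset.univ) (f := cls) (n := 2 ^ (n - k))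
    (t := g.rules ×ˢ Finset.range (2 * n) ×ˢ Finset.range (n + 1))
    (fun w _ => by
      have := hlen w
      have := hky w
      have := hyn w
      simp only [cls, Finset.mem_product, Finset.mem_range]
      exact ⟨hρ w, by omega, by omega⟩)
    (by
      simp only [Finset.card_product, Finset.card_range, Finset.card_univ, Fintype.card_fun,
        Fintype.card_bool, Fintype.card_fin]
      have hpow : 2 ^ n = 2 ^ k * 2 ^ (n - k) := by rw [← pow_add, Nat.add_sub_cancel' hkn]
      rw [hpow]
      refine Nat.mul_lt_mul_of_pos_right (lt_of_le_of_lt ?_ hk) (by positivity)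
      calc g.rules.card * (2 * n * (n + 1)) ≤ g.rules.card * (6 * n ^ 2) :=
            Nat.mul_le_mul_left _ (by nlinarith)
        _ = g.rules.card * 6 * r ^ 2 * k ^ 2 := by rw [hn]; ring)
  refine hc.not_ge ?_
  obtain ⟨w₀, hw₀⟩ := Finset.card_pos.1 (pos_of_gt hc)
  simp only [Finset.mem_filter, Finset.mem_univ, true_and] at hw₀
  subst hw₀
  refine card_le_of_eq_on (s := copyWindow n (x w₀).length (y w₀).length)
    ((hky w₀).le.trans (le_card_copyWindow (hyn w₀) ?_)) ?_
  · have := hlen w₀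
    omega
  · intro w hw w' hw' i hi
    simp only [cls, Finset.mem_filter, Finset.mem_univ, true_and, Prod.mk.injEq] at hw hw'
    obtain ⟨hρw, hxw, hyw⟩ := hw
    obtain ⟨hρw', hxw', hyw'⟩ := hw'
    refine eq_on_copyWindow_of_interchange (hxyz w) (hxyz w') (hxw'.trans hxw.symm)
      (hyw'.trans hyw.symm) (hyn w) ?_ (by rwa [hxw, hyw])
    rw [← hg]
    exact hrep w _ (by rw [hρw, ← hρw']; exact hder w')

/-- States of the three-stack automaton for the copy language. -/
inductive CopyState
  /-- the start state, accepting the empty word -/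
  | start
  /-- pushing the first `u` to stack 1 -/
  | load
  /-- pushing the first `v` to stack 2 while moving stack 1 to stack 3 -/
  | shift
  /-- one of the two symbols at the end of the first copy has been read -/
  | tail (x : Bool)
  /-- matching the second copy, which must end in the given one or two symbols -/
  | check (o : Option Bool) (x : Bool)
  /-- the second copy has been matched -/
  | done

instance : Finite CopyState := by
  let f : CopyState → Option (Option (Option (Option (Bool ⊕ Option Bool × Bool)))) := fun
    | .start => none
    | .load => some none
    | .shift => some (some none)
    | .done => some (some (some none))
    | .tail x => some (some (some (some (.inl x))))
    | .check o x => some (some (some (some (.inr (o, x)))))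
  refine Finite.of_injective f fun a b h => ?_
  cases a <;> cases b <;> simp_all [f]

/-- Transitions of the three-stack automaton for the copy language. The bottom symbol is `none`;
a copy is split as `u ++ v ++ t` with `u.length = v.length` and `t` of length one or two. -/
inductive CopyTransition :
    CopyState × (Fin 3 → Option Bool) × Bool × CopyState × (Fin 3 → StackOp (Option Bool)) → Prop
  | load {q : CopyState} (hq : q = .start ∨ q = .load) (tops : Fin 3 → Option Bool) (x : Bool) :
      CopyTransition (q, tops, x, .load, ![.push (some x), .noop, .noop])
  | shift {q : CopyState} (hq : q = .load ∨ q = .shift) (tops : Fin 3 → Option Bool)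
      (x y : Bool) (h₀ : tops 0 = some y) :
      CopyTransition (q, tops, x, .shift, ![.pop, .push (some x), .push (some y)])
  | tail {q : CopyState} (hq : q = .start ∨ q = .shift) (tops : Fin 3 → Option Bool)
      (x : Bool) (h₀ : tops 0 = none) :
      CopyTransition (q, tops, x, .tail x, fun _ => .noop)
  | tail_one {q : CopyState} (hq : q = .start ∨ q = .shift) (tops : Fin 3 → Option Bool)
      (x : Bool) (h₀ : tops 0 = none) :
      CopyTransition (q, tops, x, .check none x, fun _ => .noop)
  | tail_two (tops : Fin 3 → Option Bool) (x y : Bool) :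
      CopyTransition (.tail x, tops, y, .check (some x) y, fun _ => .noop)
  | match_first (o : Option Bool) (e : Bool) (tops : Fin 3 → Option Bool) (x y : Bool)
      (h₁ : tops 1 = some y) (h₂ : tops 2 = some x) :
      CopyTransition (.check o e, tops, x, .check o e, ![.push (some y), .pop, .pop])
  | match_second (o : Option Bool) (e : Bool) (tops : Fin 3 → Option Bool) (x : Bool)
      (h₀ : tops 0 = some x) (h₁ : tops 1 = none) (h₂ : tops 2 = none) :
      CopyTransition (.check o e, tops, x, .check o e, ![.pop, .noop, .noop])
  | match_tail (e : Bool) (tops : Fin 3 → Option Bool) (x : Bool)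
      (h : ∀ i, tops i = none) :
      CopyTransition (.check (some x) e, tops, x, .check none e, fun _ => .noop)
  | finish (tops : Fin 3 → Option Bool) (x : Bool) (h : ∀ i, tops i = none) :
      CopyTransition (.check none x, tops, x, .done, fun _ => .noop)

/-- The three-stack automaton recognizing the copy language. -/
noncomputable def copyAutomaton : MultiStackAutomaton 3 Bool where
  Q := CopyState
  Γ := Option Bool
  finQ := Fintype.ofFinite _
  q0 := .start
  F := {.start, .done}
  bot := none
  δ := {p | CopyTransition p}

namespace copyAutomaton

/-- The stacks holding the given words above the bottom symbol. -/
def stackTriple (X Y Z : List Bool) : Fin 3 → List (Option Bool) :=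
  ![X.map some ++ [none], Y.map some ++ [none], Z.map some ++ [none]]

/-- The automaton can accept the remaining input `w` from state `q` with the given words on its
stacks. -/
def AcceptsFrom (q : CopyState) (X Y Z w : List Bool) : Prop :=
  ∃ c : copyAutomaton.Q × (Fin 3 → List copyAutomaton.Γ),
    c.1 ∈ copyAutomaton.F ∧ copyAutomaton.Steps (q, stackTriple X Y Z) w c

theorem head?_stack (X : List Bool) : (X.map some ++ [none]).head? = some X.head? := by
  cases X <;> rfl

theorem acceptsFrom_nil_iff {q : CopyState} {X Y Z : List Bool} :
    AcceptsFrom q X Y Z [] ↔ q = .start ∨ q = .done := by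
  constructor
  · rintro ⟨c, hc, h⟩
    cases h
    exact hc
  · exact fun h => ⟨(q, stackTriple X Y Z), h, .refl _⟩

theorem acceptsFrom_cons_iff {q : CopyState} {X Y Z w : List Bool} {x : Bool} :
    AcceptsFrom q X Y Z (x :: w) ↔ ∃ r ops,
      CopyTransition (q, ![X.head?, Y.head?, Z.head?], x, r, ops) ∧
      ∃ c : copyAutomaton.Q × (Fin 3 → List copyAutomaton.Γ), c.1 ∈ copyAutomaton.F ∧
        copyAutomaton.Steps (r, fun i => (ops i).apply (stackTriple X Y Z i)) w c := by
  constructor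
  · rintro ⟨c, hc, h⟩
    cases h with
    | @step _ tops _ r ops _ _ _ hδ htops hsteps =>
      have : tops = ![X.head?, Y.head?, Z.head?] := by
        funext i
        fin_cases i
        exacts [Option.some.inj ((htops 0).symm.trans (head?_stack X)),
          Option.some.inj ((htops 1).symm.trans (head?_stack Y)),
          Option.some.inj ((htops 2).symm.trans (head?_stack Z))]
      subst this
      exact ⟨r, ops, hδ, c, hc, hsteps⟩
  · rintro ⟨r, ops, hδ, c, hc, hsteps⟩
    refine ⟨c, hc, .step (M := copyAutomaton) (q := q) (r := r) (ops := ops)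
      (tops := (![X.head?, Y.head?, Z.head?] : Fin 3 → Option Bool)) hδ (fun i => ?_) hsteps⟩
    fin_cases i
    exacts [head?_stack X, head?_stack Y, head?_stack Z]

theorem apply_load (x : Bool) (X Y Z : List Bool) :
    (fun i => ((![.push (some x), .noop, .noop] : Fin 3 → StackOp (Option Bool)) i).apply
      (stackTriple X Y Z i)) = stackTriple (x :: X) Y Z := by
  funext i; fin_cases i <;> rfl

theorem apply_shift (x y : Bool) (X Y Z : List Bool) :
    (fun i => ((![.pop, .push (some x), .push (some y)] : Fin 3 → StackOp (Option Bool)) i).apply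
      (stackTriple (y :: X) Y Z i)) = stackTriple X (x :: Y) (y :: Z) := by
  funext i; fin_cases i <;> rfl

theorem apply_match_first (x y : Bool) (X Y Z : List Bool) :
    (fun i => ((![.push (some y), .pop, .pop] : Fin 3 → StackOp (Option Bool)) i).apply
      (stackTriple X (y :: Y) (x :: Z) i)) = stackTriple (y :: X) Y Z := by
  funext i; fin_cases i <;> rfl

theorem apply_match_second (x : Bool) (X Y Z : List Bool) :
    (fun i => ((![.pop, .noop, .noop] : Fin 3 → StackOp (Option Bool)) i).apply
      (stackTriple (x :: X) Y Z i)) = stackTriple X Y Z := by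
  funext i; fin_cases i <;> rfl

theorem not_acceptsFrom_done_cons {X Y Z w : List Bool} {x : Bool} :
    ¬ AcceptsFrom .done X Y Z (x :: w) := by
  rw [acceptsFrom_cons_iff]
  rintro ⟨r, ops, hδ, -⟩
  cases hδ <;> simp_all

theorem acceptsFrom_check_iff {o : Option Bool} {e : Bool} {X Y Z w : List Bool} :
    AcceptsFrom (.check o e) X Y Z w ↔
      Y.length = Z.length ∧ w = Z ++ Y.reverse ++ X ++ o.toList ++ [e] := by
  constructor
  · intro h
    induction w generalizing o X Y Z with
    | nil => simp [acceptsFrom_nil_iff] at h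
    | cons a w ih =>
      rw [acceptsFrom_cons_iff] at h
      obtain ⟨r, ops, hδ, h⟩ := h
      cases hδ with
      | load hq => simp at hq
      | shift hq => simp at hq
      | tail hq => simp at hq
      | tail_one hq => simp at hq
      | match_first _ _ _ _ y h₁ h₂ =>
        cases Y with
        | nil => simp at h₁
        | cons y' Y =>
        cases Z with
        | nil => simp at h₂
        | cons a' Z =>
        obtain rfl : y' = y := by simpa using h₁
        obtain rfl : a' = a := by simpa using h₂
        rw [apply_match_first] at h
        obtain ⟨hl, rfl⟩ := ih h
        simpa using hl
      | match_second _ _ _ _ h₀ h₁ h₂ =>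
        obtain rfl : Y = [] := by simpa using h₁
        obtain rfl : Z = [] := by simpa using h₂
        cases X with
        | nil => simp at h₀
        | cons a' X =>
        obtain rfl : a' = a := by simpa using h₀
        rw [apply_match_second] at h
        obtain ⟨-, rfl⟩ := ih h
        simp
      | match_tail _ _ _ h₀ =>
        obtain rfl : X = [] := by simpa using h₀ 0
        obtain rfl : Y = [] := by simpa using h₀ 1
        obtain rfl : Z = [] := by simpa using h₀ 2
        obtain ⟨-, rfl⟩ := ih h
        simp
      | finish _ _ h₀ =>
        obtain rfl : X = [] := by simpa using h₀ 0
        obtain rfl : Y = [] := by simpa using h₀ 1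
        obtain rfl : Z = [] := by simpa using h₀ 2
        cases w with
        | nil => simp
        | cons b w => exact absurd h not_acceptsFrom_done_cons
  · rintro ⟨hl, rfl⟩
    induction Z generalizing X Y with
    | nil =>
      obtain rfl : Y = [] := by simpa using hl
      simp only [List.reverse_nil, List.nil_append]
      induction X with
      | nil =>
        have hfin : AcceptsFrom (.check none e) [] [] [] [e] :=
          acceptsFrom_cons_iff.2 ⟨_, _, .finish _ _ (by intro i; fin_cases i <;> rfl),
            acceptsFrom_nil_iff.2 (.inr rfl)⟩
        cases o with
        | none => exact hfin
        | some x =>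
          exact acceptsFrom_cons_iff.2
            ⟨_, _, .match_tail _ _ _ (by intro i; fin_cases i <;> rfl), hfin⟩
      | cons x X ih =>
        refine acceptsFrom_cons_iff.2 ⟨_, _, .match_second _ _ _ x rfl rfl rfl, ?_⟩
        rw [apply_match_second]
        exact ih
    | cons z Z ih =>
      cases Y with
      | nil => simp at hl
      | cons y Y =>
      refine acceptsFrom_cons_iff.2 ⟨_, _, .match_first _ _ _ z y rfl rfl, ?_⟩
      rw [apply_match_first]
      simpa [AcceptsFrom] using ih (X := y :: X) (Y := Y) (by simpa using hl)

theorem acceptsFrom_tail_iff {x : Bool} {X Y Z w : List Bool} :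
    AcceptsFrom (.tail x) X Y Z w ↔
      Y.length = Z.length ∧ ∃ y, w = y :: (Z ++ Y.reverse ++ X ++ [x, y]) := by
  cases w with
  | nil => simp [acceptsFrom_nil_iff]
  | cons a w =>
    rw [acceptsFrom_cons_iff]
    constructor
    · rintro ⟨r, ops, hδ, h⟩
      cases hδ with
      | load hq => simp at hq
      | shift hq => simp at hq
      | tail hq => simp at hq
      | tail_one hq => simp at hq
      | tail_two =>
        obtain ⟨hl, rfl⟩ := acceptsFrom_check_iff.1 h
        exact ⟨hl, a, by simp⟩
    · rintro ⟨hl, y, hw⟩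
      obtain ⟨rfl, rfl⟩ := List.cons.inj hw
      exact ⟨_, _, .tail_two _ _ _, acceptsFrom_check_iff.2 ⟨hl, by simp⟩⟩

/-- From a state in which the first copy has been read up to its last one or two symbols, guessing
those symbols and then matching the second copy. -/
theorem exists_tail_of_tail_transitions {Y Z w : List Bool} {a : Bool}
    (h : AcceptsFrom (.tail a) [] Y Z w ∨ AcceptsFrom (.check none a) [] Y Z w) :
    ∃ t : List Bool, (t.length = 1 ∨ t.length = 2) ∧ a :: w = t ++ Z ++ Y.reverse ++ t := by
  rcases h with h | h
  · obtain ⟨-, y, rfl⟩ := acceptsFrom_tail_iff.1 h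
    exact ⟨[a, y], .inr rfl, by simp⟩
  · obtain ⟨-, rfl⟩ := acceptsFrom_check_iff.1 h
    exact ⟨[a], .inl rfl, by simp⟩

theorem acceptsFrom_of_tail {q : CopyState} (hq : q = .start ∨ q = .shift) {Y Z t : List Bool}
    (hl : Y.length = Z.length) (ht : t.length = 1 ∨ t.length = 2) :
    AcceptsFrom q [] Y Z (t ++ Z ++ Y.reverse ++ t) := by
  rcases ht with ht | ht
  · obtain ⟨x, rfl⟩ := List.length_eq_one_iff.1 ht
    exact acceptsFrom_cons_iff.2 ⟨_, _, .tail_one hq _ _ rfl,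
      acceptsFrom_check_iff.2 ⟨hl, by simp⟩⟩
  · obtain ⟨x, y, rfl⟩ := List.length_eq_two.1 ht
    exact acceptsFrom_cons_iff.2 ⟨_, _, .tail hq _ _ rfl,
      acceptsFrom_tail_iff.2 ⟨hl, y, by simp⟩⟩

theorem acceptsFrom_shift_iff {X Y Z w : List Bool} (hl : Y.length = Z.length) :
    AcceptsFrom .shift X Y Z w ↔ ∃ v t : List Bool, v.length = X.length ∧
      (t.length = 1 ∨ t.length = 2) ∧
      w = v ++ t ++ X.reverse ++ Z ++ Y.reverse ++ v ++ t := by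
  constructor
  · intro h
    induction w generalizing X Y Z with
    | nil => simp [acceptsFrom_nil_iff] at h
    | cons a w ih =>
      rw [acceptsFrom_cons_iff] at h
      obtain ⟨r, ops, hδ, h⟩ := h
      cases hδ with
      | load hq => simp at hq
      | shift _ _ _ y h₀ =>
        cases X with
        | nil => simp at h₀
        | cons y' X =>
        obtain rfl : y' = y := by simpa using h₀
        rw [apply_shift] at h
        obtain ⟨v, t, hv, ht, rfl⟩ := ih (by simpa using hl) h
        exact ⟨a :: v, t, by simpa using hv, ht, by simp⟩
      | tail _ _ _ h₀ =>
        obtain rfl : X = [] := by simpa using h₀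
        obtain ⟨t, ht, htw⟩ := exists_tail_of_tail_transitions (.inl h)
        exact ⟨[], t, rfl, ht, by simpa using htw⟩
      | tail_one _ _ _ h₀ =>
        obtain rfl : X = [] := by simpa using h₀
        obtain ⟨t, ht, htw⟩ := exists_tail_of_tail_transitions (.inr h)
        exact ⟨[], t, rfl, ht, by simpa using htw⟩
  · rintro ⟨v, t, hv, ht, rfl⟩
    induction v generalizing X Y Z with
    | nil =>
      obtain rfl : X = [] := by simpa [eq_comm] using hv
      simpa using acceptsFrom_of_tail (.inr rfl) hl ht
    | cons x v ih =>
      cases X with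
      | nil => simp at hv
      | cons y X =>
      refine acceptsFrom_cons_iff.2 ⟨_, _, .shift (.inr rfl) _ x y rfl, ?_⟩
      rw [apply_shift]
      simpa [AcceptsFrom] using
        ih (X := X) (Y := x :: Y) (Z := y :: Z) (by simpa using hl) (by simpa using hv)

theorem acceptsFrom_load_iff {X w : List Bool} :
    AcceptsFrom .load X [] [] w ↔ ∃ u v t : List Bool, 0 < v.length ∧
      v.length = X.length + u.length ∧ (t.length = 1 ∨ t.length = 2) ∧
      w = u ++ v ++ t ++ X.reverse ++ u ++ v ++ t := by
  constructor
  · intro h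
    induction w generalizing X with
    | nil => simp [acceptsFrom_nil_iff] at h
    | cons a w ih =>
      rw [acceptsFrom_cons_iff] at h
      obtain ⟨r, ops, hδ, h⟩ := h
      cases hδ with
      | load _ =>
        rw [apply_load] at h
        obtain ⟨u, v, t, hv₀, hv, ht, rfl⟩ := ih h
        exact ⟨a :: u, v, t, hv₀, by simp at hv ⊢; omega, ht, by simp⟩
      | shift _ _ _ y h₀ =>
        cases X with
        | nil => simp at h₀
        | cons y' X =>
        obtain rfl : y' = y := by simpa using h₀
        rw [apply_shift] at h
        obtain ⟨v, t, hv, ht, rfl⟩ := (acceptsFrom_shift_iff (Y := [a]) (Z := [y']) rfl).1 h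
        exact ⟨[], a :: v, t, by simp, by simpa using hv, ht, by simp⟩
      | tail hq => simp at hq
      | tail_one hq => simp at hq
  · rintro ⟨u, v, t, hv₀, hv, ht, rfl⟩
    induction u generalizing X with
    | nil =>
      cases v with
      | nil => simp at hv₀
      | cons x v =>
      cases X with
      | nil => simp at hv
      | cons y X =>
      refine acceptsFrom_cons_iff.2 ⟨_, _, .shift (.inl rfl) _ x y rfl, ?_⟩
      rw [apply_shift]
      exact (acceptsFrom_shift_iff (Y := [x]) (Z := [y]) rfl).2
        ⟨v, t, by simpa using hv, ht, by simp⟩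
    | cons x u ih =>
      refine acceptsFrom_cons_iff.2 ⟨_, _, .load (.inr rfl) _ x, ?_⟩
      rw [apply_load]
      simpa [AcceptsFrom] using ih (X := x :: X) (by simp at hv ⊢; omega)

theorem acceptsFrom_start_iff {w : List Bool} :
    AcceptsFrom .start [] [] [] w ↔ w = [] ∨ ∃ u v t : List Bool, v.length = u.length ∧
      (t.length = 1 ∨ t.length = 2) ∧ w = (u ++ v ++ t) ++ (u ++ v ++ t) := by
  constructor
  · intro h
    cases w with
    | nil => exact .inl rfl
    | cons a w =>
      right
      rw [acceptsFrom_cons_iff] at h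
      obtain ⟨r, ops, hδ, h⟩ := h
      cases hδ with
      | load _ =>
        rw [apply_load] at h
        obtain ⟨u, v, t, -, hv, ht, rfl⟩ := acceptsFrom_load_iff.1 h
        exact ⟨a :: u, v, t, by simp at hv ⊢; omega, ht, by simp⟩
      | shift hq => simp at hq
      | tail =>
        obtain ⟨t, ht, htw⟩ := exists_tail_of_tail_transitions (Y := []) (Z := []) (.inl h)
        exact ⟨[], [], t, rfl, ht, by simpa using htw⟩
      | tail_one =>
        obtain ⟨t, ht, htw⟩ := exists_tail_of_tail_transitions (Y := []) (Z := []) (.inr h)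
        exact ⟨[], [], t, rfl, ht, by simpa using htw⟩
  · rintro (rfl | ⟨u, v, t, hv, ht, rfl⟩)
    · exact acceptsFrom_nil_iff.2 (.inl rfl)
    · cases u with
      | nil =>
        obtain rfl : v = [] := by simpa using hv
        simpa using acceptsFrom_of_tail (Y := []) (Z := []) (.inl rfl) rfl ht
      | cons x u =>
        refine acceptsFrom_cons_iff.2 ⟨_, _, .load (.inl rfl) _ x, ?_⟩
        rw [apply_load]
        exact acceptsFrom_load_iff.2
          ⟨u, v, t, by simp [hv], by simp at hv ⊢; omega, ht, by simp⟩

theorem exists_halves_append_tail {w : List Bool} (hw : w ≠ []) :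
    ∃ u v t : List Bool, v.length = u.length ∧ (t.length = 1 ∨ t.length = 2) ∧
      w = u ++ v ++ t := by
  have := List.length_pos_iff.2 hw
  set n := (w.length - 1) / 2
  refine ⟨w.take n, (w.drop n).take n, (w.drop n).drop n, ?_, ?_, ?_⟩
  · simp; omega
  · simp; omega
  · simp

theorem language_eq : copyAutomaton.language = wwLanguage := by
  ext w
  have h : w ∈ copyAutomaton.language ↔ AcceptsFrom .start [] [] [] w := by
    have hs : stackTriple [] [] [] = fun _ => [none] := by
      funext i; fin_cases i <;> rfl
    rw [AcceptsFrom, hs]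
    rfl
  rw [h, acceptsFrom_start_iff]
  constructor
  · rintro (rfl | ⟨u, v, t, -, -, rfl⟩)
    · exact ⟨[], rfl⟩
    · exact ⟨_, rfl⟩
  · rintro ⟨w, rfl⟩
    rcases eq_or_ne w [] with rfl | hw
    · exact .inl rfl
    · obtain ⟨u, v, t, hv, ht, rfl⟩ := exists_halves_append_tail hw
      exact .inr ⟨u, v, t, hv, ht, rfl⟩

end copyAutomaton

/-- The copy language `{ w w | w ∈ {0, 1}* }` is not context-free, but it is
recognized by a (nondeterministic) real-time three-stack automaton. -/
theorem ww_recognized_by_three_stack :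
    ¬ wwLanguage.IsContextFree ∧
      ∃ M : MultiStackAutomaton 3 Bool, M.language = wwLanguage := by
  exact ⟨not_isContextFree_wwLanguage, copyAutomaton, copyAutomaton.language_eq⟩
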